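/- arXiv:1802.03132 — 4 statements merged into one kernel-verified Lean document; each statement's English description precedes it below -/
import Mathlib

section
/- Let γ:[0,1]→X be an absolutely continuous rectifiable path in a metric space (X,d), and let F⊂X be a Borel set. If m₁(γ⁻¹(F))=0, then m₁(γ_s⁻¹(F))=0, where m₁ is Lebesgue measure on ℝ. In particular, if such a γ has positive length in F, then it also spends positive time in F. -/
open MeasureTheory
open scoped ENNReal

/-- A path `γ : [0,1] → X` into a metric space is absolutely continuous if for every
`ε > 0` there is `δ > 0` such that for any finite collection of disjoint intervals
`(cᵢ, dᵢ) ⊆ [0,1]` with `Σ (dᵢ - cᵢ) < δ` one has `Σ dist (γ cᵢ) (γ dᵢ) < ε`. -/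
def AbsolutelyContinuousPath {X : Type*} [MetricSpace X] (γ : ℝ → X) : Prop :=
  ∀ ε > (0:ℝ), ∃ δ > (0:ℝ), ∀ n : ℕ, ∀ c d : Fin n → ℝ,
    (∀ i, c i ∈ Set.Icc (0:ℝ) 1) → (∀ i, d i ∈ Set.Icc (0:ℝ) 1) → (∀ i, c i < d i) →
    (Pairwise fun i j => Disjoint (Set.Ioo (c i) (d i)) (Set.Ioo (c j) (d j))) →
    (∑ i, (d i - c i)) < δ → (∑ i, dist (γ (c i)) (γ (d i))) < ε

/-- The length function `s_γ(t) = length(γ|_{[0,t]})` of a path `γ : [0,1] → X`. -/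
noncomputable def lenFun {X : Type*} [MetricSpace X] (γ : ℝ → X) (t : ℝ) : ℝ :=
  (eVariationOn γ (Set.Icc (0:ℝ) t)).toReal

/-- The right inverse `s_γ⁻¹(t) = max {s ∈ [0,1] : s_γ(s) = t}` of the length function. -/
noncomputable def lenInv {X : Type*} [MetricSpace X] (γ : ℝ → X) (t : ℝ) : ℝ :=
  sSup {s | s ∈ Set.Icc (0:ℝ) 1 ∧ lenFun γ s = t}

/-- The arc-length parametrization `γ_s(t) = γ(s_γ⁻¹(t))`. -/
noncomputable def arcParam {X : Type*} [MetricSpace X] (γ : ℝ → X) (t : ℝ) : X :=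
  γ (lenInv γ t)

open Set Filter Topology in
/-- A right inverse of a monotone absolutely continuous function pulls null sets back to
null sets. -/
theorem AbsolutelyContinuousOnInterval.volume_preimage_rightInverse_eq_zero {f T : ℝ → ℝ} {a b : ℝ}
    (hf : AbsolutelyContinuousOnInterval f a b) (hab : a ≤ b) (hmono : MonotoneOn f (Icc a b))
    (hT : MapsTo T (Icc (f a) (f b)) (Icc a b)) (hfT : ∀ t ∈ Icc (f a) (f b), f (T t) = t)
    {E : Set ℝ} (hE : volume E = 0) : volume (Icc (f a) (f b) ∩ T ⁻¹' E) = 0 := by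
  have hTmono : MonotoneOn T (Icc (f a) (f b)) := by
    intro t ht u hu htu
    by_contra! h
    have := hmono (hT hu) (hT ht) h.le
    rw [hfT t ht, hfT u hu] at this
    exact h.ne (by rw [le_antisymm htu this])
  have hTmeas : AEMeasurable T (volume.restrict (Icc (f a) (f b))) :=
    aemeasurable_restrict_of_monotoneOn measurableSet_Icc hTmono
  have hmap : (volume.restrict (Icc (f a) (f b))).map T =
      (volume.restrict (Ioc a b)).withDensity fun x => ENNReal.ofReal (deriv f x) := by
    refine Measure.ext_of_Iic _ _ fun x => ?_
    rw [Measure.map_apply_of_aemeasurable hTmeas measurableSet_Iic,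
      Measure.restrict_apply' measurableSet_Icc, withDensity_apply _ measurableSet_Iic,
      Measure.restrict_restrict measurableSet_Iic, inter_comm (Iic x), Ioc_inter_Iic]
    rcases lt_or_ge x a with hx | hx
    · rw [Ioc_eq_empty (by simp [hx.le]), Measure.restrict_empty, lintegral_zero_measure]
      convert! measure_empty (μ := (volume : Measure ℝ))
      ext t
      simp only [mem_inter_iff, mem_preimage, mem_Iic, mem_empty_iff_false, iff_false, not_and]
      exact fun h ht => absurd ((hT ht).1.trans h) (not_le.2 hx)
    set y := b ⊓ x with hy
    have hay : a ≤ y := le_inf hab hx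
    have hyb : y ≤ b := inf_le_left
    have hyx : y ≤ x := inf_le_right
    have hacy : AbsolutelyContinuousOnInterval f a y :=
      hf.mono (by rw [uIcc_of_le hay, uIcc_of_le hab]; exact Icc_subset_Icc_right hyb)
    have hint := hacy.intervalIntegrable_deriv
    rw [intervalIntegrable_iff_integrableOn_Ioc_of_le hay] at hint
    have hnonneg : 0 ≤ᵐ[volume.restrict (Ioc a y)] deriv f := by
      rw [← restrict_Ioo_eq_restrict_Ioc]
      filter_upwards [ae_restrict_mem measurableSet_Ioo] with z hz
      rw [← derivWithin_of_mem_nhds (Icc_mem_nhds hz.1 (hz.2.trans_le hyb))]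
      exact hmono.derivWithin_nonneg
    rw [← ofReal_integral_eq_lintegral_ofReal hint hnonneg,
      ← intervalIntegral.integral_of_le hay, hacy.integral_deriv_eq_sub]
    have hfy : f y ≤ f b := hmono ⟨hay, hyb⟩ ⟨hab, le_rfl⟩ hyb
    refine le_antisymm ?_ ?_
    · rw [← Real.volume_Icc]
      refine measure_mono fun t ⟨ht, htI⟩ => ⟨htI.1, ?_⟩
      rw [← hfT t htI]
      exact hmono (hT htI) ⟨hay, hyb⟩ (le_inf (hT htI).2 ht)
    · rw [← Real.volume_Ico]
      refine measure_mono fun t ht => ?_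
      have htI : t ∈ Icc (f a) (f b) := ⟨ht.1, ht.2.le.trans hfy⟩
      refine ⟨?_, htI⟩
      by_contra h
      have := hmono ⟨hay, hyb⟩ (hT htI) (hyx.trans (not_le.1 h).le)
      rw [hfT t htI] at this
      exact ht.2.not_ge this
  rw [inter_comm, ← Measure.restrict_apply' measurableSet_Icc]
  refine Measure.preimage_null_of_map_null hTmeas ?_
  rw [hmap]
  exact withDensity_absolutelyContinuous _ _ (Measure.absolutelyContinuous_of_le
    Measure.restrict_le_self hE)

/-- Absolute continuity tested on disjoint intervals indexed by an arbitrary finite type. -/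
theorem AbsolutelyContinuousPath.exists_forall_fintype {X : Type*} [MetricSpace X] {γ : ℝ → X}
    (hγ : AbsolutelyContinuousPath γ) {ε : ℝ} (hε : 0 < ε) :
    ∃ δ > (0 : ℝ), ∀ (ι : Type) [Fintype ι] (c d : ι → ℝ),
      (∀ i, c i ∈ Set.Icc (0 : ℝ) 1) → (∀ i, d i ∈ Set.Icc (0 : ℝ) 1) → (∀ i, c i < d i) →
      (Pairwise fun i j => Disjoint (Set.Ioo (c i) (d i)) (Set.Ioo (c j) (d j))) →
      (∑ i, (d i - c i)) < δ → (∑ i, dist (γ (c i)) (γ (d i))) < ε := by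
  obtain ⟨δ, hδ, h⟩ := hγ ε hε
  refine ⟨δ, hδ, fun ι _ c d hc hd hcd hdisj hsum => ?_⟩
  let e := (Fintype.equivFin ι).symm
  rw [← e.sum_comp] at hsum ⊢
  exact h _ (c ∘ e) (d ∘ e) (fun i => hc _) (fun i => hd _) (fun i => hcd _)
    (fun i j hij => hdisj (e.injective.ne hij)) hsum

open Set in
/-- A finite variation on a nonempty set is approximated by the sum over a strictly increasing
subdivision. -/
theorem BoundedVariationOn.exists_strictMonoOn_sum_dist {X : Type*} [PseudoMetricSpace X]
    {γ : ℝ → X} {s : Set ℝ} (h : BoundedVariationOn γ s) (hs : s.Nonempty) {η : ℝ} (hη : 0 < η) :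
    ∃ (m : ℕ) (u : ℕ → ℝ), StrictMonoOn u (Iic m) ∧ (∀ i ∈ Iic m, u i ∈ s) ∧
      (eVariationOn γ s).toReal ≤ ∑ i : Fin m, dist (γ (u i)) (γ (u (i + 1))) + η := by
  rcases lt_or_ge η (eVariationOn γ s).toReal with hlt | hge
  · have hv : ENNReal.ofReal ((eVariationOn γ s).toReal - η) < eVariationOn γ s :=
      (ENNReal.ofReal_lt_iff_lt_toReal (sub_nonneg.2 hlt.le) h).2 (sub_lt_self _ hη)
    conv_rhs at hv => rw [eVariationOn.eVariationOn_eq_strictMonoOn]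
    obtain ⟨⟨m, u, hu, hmem⟩, hmu⟩ := lt_iSup_iff.1 hv
    refine ⟨m, u, hu, hmem, sub_le_iff_le_add.1 ?_⟩
    simp only [edist_dist] at hmu
    rw [← ENNReal.ofReal_sum_of_nonneg fun _ _ => dist_nonneg] at hmu
    rw [Fin.sum_univ_eq_sum_range (fun j => dist (γ (u j)) (γ (u (j + 1))))]
    simpa only [dist_comm] using (ENNReal.ofReal_lt_ofReal_iff'.1 hmu).1.le
  · obtain ⟨x, hx⟩ := hs
    exact ⟨0, fun _ => x, fun i hi j hj hij => absurd (hij.trans_le hj) (by simp),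
      fun _ _ => hx, by simpa using hge⟩

theorem lenFun_sub_lenFun {X : Type*} [MetricSpace X] {γ : ℝ → X}
    (hγ : BoundedVariationOn γ (Set.Icc (0 : ℝ) 1)) {a b : ℝ} (ha : 0 ≤ a) (hab : a ≤ b)
    (hb : b ≤ 1) : lenFun γ b - lenFun γ a = (eVariationOn γ (Set.Icc a b)).toReal := by
  have h := eVariationOn.Icc_add_Icc γ ha hab (Set.mem_univ a)
  simp only [Set.univ_inter] at h
  rw [lenFun, lenFun, ← h, ENNReal.toReal_add, add_sub_cancel_left]
  · exact hγ.mono (Set.Icc_subset_Icc_right (hab.trans hb))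
  · exact hγ.mono (Set.Icc_subset_Icc ha hb)

theorem lenFun_zero {X : Type*} [MetricSpace X] (γ : ℝ → X) : lenFun γ 0 = 0 := by
  simp [lenFun]

theorem monotoneOn_lenFun {X : Type*} [MetricSpace X] {γ : ℝ → X}
    (hγ : BoundedVariationOn γ (Set.Icc (0 : ℝ) 1)) : MonotoneOn (lenFun γ) (Set.Icc 0 1) :=
  fun _ ha _ hb hab => sub_nonneg.1 <| by
    rw [lenFun_sub_lenFun hγ ha.1 hab hb.2]
    exact ENNReal.toReal_nonneg

open Set in
/-- The length function of an absolutely continuous path is absolutely continuous. -/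
theorem AbsolutelyContinuousPath.absolutelyContinuousOnInterval_lenFun {X : Type*} [MetricSpace X]
    {γ : ℝ → X} (hac : AbsolutelyContinuousPath γ)
    (hγ : BoundedVariationOn γ (Icc (0 : ℝ) 1)) :
    AbsolutelyContinuousOnInterval (lenFun γ) 0 1 := by
  rw [absolutelyContinuousOnInterval_iff]
  intro ε hε
  obtain ⟨δ, hδ, h⟩ := hac.exists_forall_fintype (half_pos hε)
  refine ⟨δ, hδ, ?_⟩
  rintro ⟨n, I⟩ ⟨hI, hdisj⟩ hsum
  simp only [Finset.mem_range, uIcc_of_le zero_le_one] at hI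
  simp only [Finset.sum_range] at hsum ⊢
  have hmin (i : Fin n) : 0 ≤ min (I i).1 (I i).2 := le_min (hI i i.2).1.1 (hI i i.2).2.1
  have hmax (i : Fin n) : max (I i).1 (I i).2 ≤ 1 := max_le (hI i i.2).1.2 (hI i i.2).2.2
  have hsub (i : Fin n) : uIcc (I i).1 (I i).2 ⊆ Icc 0 1 := Icc_subset_Icc (hmin i) (hmax i)
  have hdist (i : Fin n) : dist (lenFun γ (I i).1) (lenFun γ (I i).2) =
      (eVariationOn γ (uIcc (I i).1 (I i).2)).toReal := by
    rcases le_total (I i).1 (I i).2 with hle | hle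
    · rw [uIcc_of_le hle, ← lenFun_sub_lenFun hγ (hI i i.2).1.1 hle (hI i i.2).2.2, dist_comm,
        Real.dist_eq, abs_of_nonneg]
      exact sub_nonneg.2 (monotoneOn_lenFun hγ (hI i i.2).1 (hI i i.2).2 hle)
    · rw [uIcc_of_ge hle, ← lenFun_sub_lenFun hγ (hI i i.2).2.1 hle (hI i i.2).1.2,
        Real.dist_eq, abs_of_nonneg]
      exact sub_nonneg.2 (monotoneOn_lenFun hγ (hI i i.2).2 (hI i i.2).1 hle)
  have hη : 0 < ε / (2 * (n + 1)) := by positivity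
  choose m u hu hmem hle using fun i : Fin n =>
    (hγ.mono (hsub i)).exists_strictMonoOn_sum_dist nonempty_uIcc hη
  have hstep (i : Fin n) (j : Fin (m i)) : u i j < u i (j + 1) :=
    hu i j.2.le (Nat.succ_le_of_lt j.2) (Nat.lt_succ_self _)
  have hlen (i : Fin n) : ∑ j : Fin (m i), (u i (j + 1) - u i j) ≤ dist (I i).1 (I i).2 := by
    rw [Fin.sum_univ_eq_sum_range (fun j => u i (j + 1) - u i j), Finset.sum_range_sub]
    refine (le_abs_self _).trans ?_
    rw [← Real.dist_eq, dist_comm (I i).1]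
    exact Real.dist_le_of_mem_uIcc (uIcc_comm (I i).1 (I i).2 ▸ hmem i _ self_mem_Iic)
      (uIcc_comm (I i).1 (I i).2 ▸ hmem i _ (Nat.zero_le _))
  have key := h (Σ i : Fin n, Fin (m i)) (fun p => u p.1 p.2) (fun p => u p.1 (p.2 + 1))
    (fun p => hsub _ (hmem p.1 _ p.2.2.le)) (fun p => hsub _ (hmem p.1 _ p.2.2))
    (fun p => hstep p.1 p.2) ?_ ?_
  · rw [Fintype.sum_sigma] at key
    calc ∑ i : Fin n, dist (lenFun γ (I i).1) (lenFun γ (I i).2)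
        ≤ ∑ i : Fin n, (∑ j : Fin (m i), dist (γ (u i j)) (γ (u i (j + 1))) +
            ε / (2 * (n + 1))) := Finset.sum_le_sum fun i _ => (hdist i).trans_le (hle i)
      _ < ε / 2 + n * (ε / (2 * (n + 1))) := by
          rw [Finset.sum_add_distrib]
          simpa using key
      _ ≤ ε := by
          field_simp
          linarith
  · rintro ⟨i, j⟩ ⟨i', j'⟩ hne
    dsimp only
    by_cases hii : i = i'
    · subst hii
      have hjj : (j : ℕ) ≠ j' := fun hj => hne (by rw [Fin.ext hj])
      rw [Set.disjoint_left]
      rintro x ⟨hx1, hx2⟩ ⟨hx3, hx4⟩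
      rcases lt_or_gt_of_ne hjj with hlt | hlt
      · exact absurd ((hu i).monotoneOn (Nat.succ_le_of_lt j.2) j'.2.le (Nat.succ_le_of_lt hlt))
          (not_le.2 (hx3.trans hx2))
      · exact absurd ((hu i).monotoneOn (Nat.succ_le_of_lt j'.2) j.2.le (Nat.succ_le_of_lt hlt))
          (not_le.2 (hx1.trans hx4))
    · have hIoo (i : Fin n) (j : Fin (m i)) :
          Ioo (u i j) (u i (j + 1)) ⊆ uIoc (I i).1 (I i).2 := fun x hx =>
        ⟨(hmem i j j.2.le).1.trans_lt hx.1, hx.2.le.trans (hmem i (j + 1) j.2).2⟩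
      exact (hdisj (by simp) (by simp) fun hv => hii (Fin.ext hv)).mono (hIoo i j) (hIoo i' j')
  · rw [Fintype.sum_sigma]
    exact (Finset.sum_le_sum fun i _ => hlen i).trans_lt hsum

open Set in
/-- On the range of a continuous length function the maximum defining `lenInv` is attained. -/
theorem lenInv_mem {X : Type*} [MetricSpace X] {γ : ℝ → X}
    (hcont : ContinuousOn (lenFun γ) (Icc 0 1)) {t : ℝ} (ht : t ∈ Icc (lenFun γ 0) (lenFun γ 1)) :
    lenInv γ t ∈ Icc (0 : ℝ) 1 ∧ lenFun γ (lenInv γ t) = t := by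
  have hclosed : IsClosed (Icc (0 : ℝ) 1 ∩ lenFun γ ⁻¹' {t}) :=
    hcont.preimage_isClosed_of_isClosed isClosed_Icc isClosed_singleton
  obtain ⟨x, hx, hxt⟩ := intermediate_value_Icc zero_le_one hcont ht
  exact (isCompact_Icc.of_isClosed_subset hclosed inter_subset_left).sSup_mem ⟨x, hx, hxt⟩

/-- Let `γ : [0,1] → X` be an absolutely continuous rectifiable path and `F ⊆ X` Borel.
If `m₁(γ⁻¹(F)) = 0` then `m₁(γ_s⁻¹(F)) = 0`; in particular, if `γ` has positive length
in `F` then it also spends positive time in `F`. -/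
theorem arcParam_preimage_null_of_preimage_null {X : Type*} [MetricSpace X]
    [MeasurableSpace X] [BorelSpace X]
    (γ : ℝ → X) (hcont : ContinuousOn γ (Set.Icc (0:ℝ) 1))
    (hrect : eVariationOn γ (Set.Icc (0:ℝ) 1) ≠ ∞)
    (hac : AbsolutelyContinuousPath γ)
    (F : Set X) (hF : MeasurableSet F) :
    (volume (Set.Icc (0:ℝ) 1 ∩ γ ⁻¹' F) = 0 →
      volume (Set.Icc (0:ℝ) (eVariationOn γ (Set.Icc (0:ℝ) 1)).toReal ∩ arcParam γ ⁻¹' F) = 0) ∧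
    (0 < volume (Set.Icc (0:ℝ) (eVariationOn γ (Set.Icc (0:ℝ) 1)).toReal ∩ arcParam γ ⁻¹' F) →
      0 < volume (Set.Icc (0:ℝ) 1 ∩ γ ⁻¹' F)) := by
  have hmain (h : volume (Set.Icc (0 : ℝ) 1 ∩ γ ⁻¹' F) = 0) :
      volume (Set.Icc (0 : ℝ) (lenFun γ 1) ∩ arcParam γ ⁻¹' F) = 0 := by
    have hs := hac.absolutelyContinuousOnInterval_lenFun hrect
    have hmem {t : ℝ} (ht : t ∈ Set.Icc (lenFun γ 0) (lenFun γ 1)) :=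
      lenInv_mem (by simpa using hs.continuousOn) ht
    have hnull := hs.volume_preimage_rightInverse_eq_zero zero_le_one (monotoneOn_lenFun hrect)
      (fun t ht => (hmem ht).1) (fun t ht => (hmem ht).2) h
    rw [← lenFun_zero γ]
    refine measure_mono_null ?_ hnull
    exact fun t ht => ⟨ht.1, (hmem ht.1).1, ht.2⟩
  exact ⟨hmain, fun h => pos_iff_ne_zero.2 fun h0 => h.ne' (hmain h0)⟩
end

section
/- Mod_∞^* is continuous from below: if Γ₁ ⊂ Γ₂ ⊂ ⋯ is an increasing sequence of families of rectifiable curves in a metric measure space (X,d,μ) and Γ = ⋃_{j=1}^∞ Γ_j, then lim_{j→∞} Mod_∞^*(Γ_j) = Mod_∞^*(Γ). -/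
open MeasureTheory
open scoped ENNReal

/-- A *curve* in a metric space `X`: a nonconstant continuous map from a compact
interval `[a,b] ⊆ ℝ` into `X`. -/
structure Curve (X : Type*) [MetricSpace X] where
  a : ℝ
  b : ℝ
  hab : a ≤ b
  toFun : ℝ → X
  cont : ContinuousOn toFun (Set.Icc a b)
  nonconst : ∃ s ∈ Set.Icc a b, ∃ t ∈ Set.Icc a b, toFun s ≠ toFun t

namespace Curve

variable {X : Type*} [MetricSpace X]

/-- The length of a curve: the total variation of `γ` on `[a,b]`. -/
noncomputable def length (γ : Curve X) : ℝ≥0∞ :=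
  eVariationOn γ.toFun (Set.Icc γ.a γ.b)

/-- A curve is rectifiable if it has finite length. -/
def Rectifiable (γ : Curve X) : Prop := γ.length ≠ ∞

/-- The length function `s_γ(t) = length (γ|_[a,t])`. -/
noncomputable def lenFun (γ : Curve X) (t : ℝ) : ℝ :=
  (eVariationOn γ.toFun (Set.Icc γ.a t)).toReal

/-- The right inverse `s_γ⁻¹(t) = max {s ∈ [a,b] : s_γ(s) = t}` of the length function. -/
noncomputable def lenInv (γ : Curve X) (t : ℝ) : ℝ :=
  sSup {s | s ∈ Set.Icc γ.a γ.b ∧ γ.lenFun s = t}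

/-- The arc-length parametrization `γ_s(t) = γ(s_γ⁻¹(t))`. -/
noncomputable def param (γ : Curve X) (t : ℝ) : X := γ.toFun (γ.lenInv t)

/-- The parameter domain `[0, length γ]` of the arc-length parametrization,
as a subset of `ℝ` (it is all of `[0,∞)` when `γ` has infinite length). -/
def paramDomain (γ : Curve X) : Set ℝ := {t : ℝ | 0 ≤ t ∧ ENNReal.ofReal t ≤ γ.length}

/-- The line integral `∫_γ ρ ds = ∫_0^{length γ} ρ(γ_s(t)) dt` of a density `ρ` along `γ`. -/
noncomputable def lineIntegral (γ : Curve X) (ρ : X → ℝ≥0∞) : ℝ≥0∞ :=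
  ∫⁻ t in γ.paramDomain, ρ (γ.param t)

/-- `σ` is a subcurve of `γ` if it is the restriction of `γ` to a subinterval. -/
def IsSubcurve (σ γ : Curve X) : Prop :=
  γ.a ≤ σ.a ∧ σ.b ≤ γ.b ∧ ∀ t ∈ Set.Icc σ.a σ.b, σ.toFun t = γ.toFun t

/-- A curve is locally rectifiable if every interior point of its parameter interval has a
neighbourhood on which the curve is rectifiable. -/
def LocallyRectifiable (γ : Curve X) : Prop :=
  ∀ t ∈ Set.Ioo γ.a γ.b, ∃ u v : ℝ, u < t ∧ t < v ∧
    eVariationOn γ.toFun (Set.Icc (max γ.a u) (min γ.b v)) ≠ ∞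

/-- A curve has positive length in a set `F`: `m₁(γ_s⁻¹(F)) > 0`. -/
def PosLength (γ : Curve X) (F : Set X) : Prop :=
  0 < volume (γ.paramDomain ∩ γ.param ⁻¹' F)

end Curve

section Modulus

variable {X : Type*} [MetricSpace X] [MeasurableSpace X] [BorelSpace X]

/-- A density (nonnegative Borel function) `ρ` is admissible for a curve family `Γ`
if `∫_γ ρ ds ≥ 1` for every `γ ∈ Γ`. -/
def Admissible (Γ : Set (Curve X)) (ρ : X → ℝ≥0∞) : Prop :=
  Measurable ρ ∧ ∀ γ ∈ Γ, 1 ≤ γ.lineIntegral ρ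

/-- The supremum-modulus `Mod_sup(Γ) = inf {sup_X ρ : ρ ∈ Adm(Γ)}`. -/
noncomputable def ModSup (Γ : Set (Curve X)) : ℝ≥0∞ :=
  ⨅ ρ ∈ {ρ : X → ℝ≥0∞ | Admissible Γ ρ}, ⨆ x, ρ x

/-- `Mod_∞^*(Γ) = inf {‖ρ‖_∞ : ρ ∈ Adm(Γ)}`. -/
noncomputable def ModInfty (μ : Measure X) (Γ : Set (Curve X)) : ℝ≥0∞ :=
  ⨅ ρ ∈ {ρ : X → ℝ≥0∞ | Admissible Γ ρ}, essSup ρ μ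

/-- A curve family is `∞`-exceptional if `Mod_∞^*(Γ) = 0`. -/
def Exceptional (μ : Measure X) (Γ : Set (Curve X)) : Prop :=
  ModInfty μ Γ = 0

/-- `ρ` is weakly admissible for `Γ` if `∫_γ ρ ds ≥ 1` for `∞`-a.e. curve `γ ∈ Γ`. -/
def WeaklyAdmissible (μ : Measure X) (Γ : Set (Curve X)) (ρ : X → ℝ≥0∞) : Prop :=
  Measurable ρ ∧ Exceptional μ {γ ∈ Γ | γ.lineIntegral ρ < 1}

/-- The `∞`-modulus `Mod_∞(Γ) = inf {‖ρ‖_∞ : ρ weakly admissible for Γ}`. -/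
noncomputable def ModInftyW (μ : Measure X) (Γ : Set (Curve X)) : ℝ≥0∞ :=
  ⨅ ρ ∈ {ρ : X → ℝ≥0∞ | WeaklyAdmissible μ Γ ρ}, essSup ρ μ

/-- The essential length `essℓ(Γ) = sup {a ≥ 0 : Γ(a) = {γ ∈ Γ : length γ < a} is ∞-exceptional}`. -/
noncomputable def essLen (μ : Measure X) (Γ : Set (Curve X)) : ℝ≥0∞ :=
  sSup {a : ℝ≥0∞ | Exceptional μ {γ ∈ Γ | γ.length < a}}

/-- The family `Γ(x,y)` of rectifiable curves connecting `x` to `y`. -/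
def ConnCurves (x y : X) : Set (Curve X) :=
  {γ : Curve X | γ.Rectifiable ∧ γ.toFun γ.a = x ∧ γ.toFun γ.b = y}

open scoped Classical in
/-- The essential metric `d_ess(x,y) = essℓ(Γ(x,y))` for `x ≠ y`, and `0` on the diagonal. -/
noncomputable def dEss (μ : Measure X) (x y : X) : ℝ≥0∞ :=
  if x = y then 0 else essLen μ (ConnCurves x y)

end Modulus

namespace Curve

open Set Filter Topology

variable {X : Type*} [MetricSpace X] {γ : Curve X}

lemma edist_lenFun (hγ : γ.Rectifiable) {x y : ℝ} (hx : γ.a ≤ x) (hxy : x ≤ y) (hy : y ≤ γ.b) :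
    edist (γ.lenFun x) (γ.lenFun y) = eVariationOn γ.toFun (Icc γ.a γ.b ∩ Icc x y) := by
  have hfin : ∀ s ⊆ Icc γ.a γ.b, eVariationOn γ.toFun s ≠ ∞ :=
    fun s hs => ne_top_of_le_ne_top hγ (eVariationOn.mono _ hs)
  have hadd := eVariationOn.Icc_add_Icc γ.toFun (s := univ) hx hxy (mem_univ _)
  simp only [univ_inter] at hadd
  have h₁ := hfin (Icc γ.a x) (Icc_subset_Icc_right (hxy.trans hy))
  have h₂ := hfin (Icc x y) (Icc_subset_Icc hx hy)
  rw [inter_eq_self_of_subset_right (Icc_subset_Icc hx hy), edist_comm, edist_dist,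
    Real.dist_eq, lenFun, lenFun, ← hadd, ENNReal.toReal_add h₁ h₂, add_sub_cancel_left,
    abs_of_nonneg ENNReal.toReal_nonneg, ENNReal.ofReal_toReal h₂]

lemma monotoneOn_lenFun (hγ : γ.Rectifiable) : MonotoneOn γ.lenFun (Icc γ.a γ.b) :=
  fun _ _ _ hy hxy => ENNReal.toReal_mono
    (ne_top_of_le_ne_top hγ (eVariationOn.mono _ (Icc_subset_Icc_right hy.2)))
    (eVariationOn.mono _ (Icc_subset_Icc_right hxy))

lemma continuousOn_lenFun (hγ : γ.Rectifiable) : ContinuousOn γ.lenFun (Icc γ.a γ.b) := by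
  intro x hx
  have hl := BoundedVariationOn.tendsto_eVariationOn_Icc_zero_left hγ
    ((γ.cont x hx).mono inter_subset_left)
  have hr := BoundedVariationOn.tendsto_eVariationOn_Icc_zero_right hγ x
    ((γ.cont x hx).mono inter_subset_left)
  have hsum := hl.add hr
  rw [add_zero] at hsum
  refine tendsto_iff_edist_tendsto_0.2
    (tendsto_of_tendsto_of_tendsto_of_le_of_le' tendsto_const_nhds hsum
      (Eventually.of_forall fun _ => zero_le) ?_)
  filter_upwards [self_mem_nhdsWithin] with y hy
  rcases le_total x y with h | h
  · rw [edist_comm, edist_lenFun hγ hx.1 h hy.2]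
    exact le_add_self
  · rw [edist_lenFun hγ hy.1 h hx.2]
    exact le_self_add

lemma paramDomain_eq (hγ : γ.Rectifiable) : γ.paramDomain = Icc 0 γ.length.toReal := by
  ext t
  simp only [paramDomain, mem_ofPred_eq, mem_Icc, ENNReal.ofReal_le_iff_le_toReal hγ]

lemma lenInv_mem (hγ : γ.Rectifiable) {t : ℝ} (ht : t ∈ γ.paramDomain) :
    γ.lenInv t ∈ Icc γ.a γ.b ∧ γ.lenFun (γ.lenInv t) = t := by
  have hcont := continuousOn_lenFun hγ
  have hcompact : IsCompact {s | s ∈ Icc γ.a γ.b ∧ γ.lenFun s = t} :=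
    isCompact_Icc.of_isClosed_subset
      (hcont.preimage_isClosed_of_isClosed isClosed_Icc (isClosed_singleton (x := t)))
      fun _ hs => hs.1
  have hne : {s | s ∈ Icc γ.a γ.b ∧ γ.lenFun s = t}.Nonempty := by
    refine intermediate_value_Icc γ.hab hcont ?_
    rw [paramDomain_eq hγ] at ht
    simpa [lenFun, length, eVariationOn.subsingleton] using ht
  exact hcompact.sSup_mem hne

lemma lipschitzOnWith_param (hγ : γ.Rectifiable) :
    LipschitzOnWith 1 γ.param γ.paramDomain := by
  have key : ∀ t ∈ γ.paramDomain, ∀ u ∈ γ.paramDomain, γ.lenInv t ≤ γ.lenInv u →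
      edist (γ.param t) (γ.param u) ≤ edist t u := by
    intro t ht u hu h
    obtain ⟨ht₁, ht₂⟩ := lenInv_mem hγ ht
    obtain ⟨hu₁, hu₂⟩ := lenInv_mem hγ hu
    have hd := edist_lenFun hγ ht₁.1 h hu₁.2
    rw [ht₂, hu₂] at hd
    rw [hd]
    exact eVariationOn.edist_le _ ⟨ht₁, le_rfl, h⟩ ⟨hu₁, h, le_rfl⟩
  intro t ht u hu
  rw [ENNReal.coe_one, one_mul]
  rcases le_total (γ.lenInv t) (γ.lenInv u) with h | h
  · exact key t ht u hu h
  · rw [edist_comm (γ.param t), edist_comm t]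
    exact key u hu t ht h

/-- Integration along a rectifiable curve is integration against a finite Borel measure. -/
lemma exists_lineIntegral_eq_lintegral [MeasurableSpace X] [BorelSpace X]
    (hγ : γ.Rectifiable) :
    ∃ ν : Measure X, IsFiniteMeasure ν ∧
      ∀ ρ : X → ℝ≥0∞, Measurable ρ → γ.lineIntegral ρ = ∫⁻ x, ρ x ∂ν := by
  have hmeas : MeasurableSet γ.paramDomain := paramDomain_eq hγ ▸ measurableSet_Icc
  have hparam : AEMeasurable γ.param (volume.restrict γ.paramDomain) :=
    (lipschitzOnWith_param hγ).continuousOn.aemeasurable hmeas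
  have : IsFiniteMeasure (volume.restrict γ.paramDomain) := by
    rw [paramDomain_eq hγ]
    infer_instance
  exact ⟨(volume.restrict γ.paramDomain).map γ.param, inferInstance,
    fun ρ hρ => (lintegral_map' hρ.aemeasurable hparam).symm⟩

end Curve

section Modulus

open Filter

variable {X : Type*} [MetricSpace X] [MeasurableSpace X]

lemma modInfty_mono (μ : Measure X) {Γ₁ Γ₂ : Set (Curve X)} (h : Γ₁ ⊆ Γ₂) :
    ModInfty μ Γ₁ ≤ ModInfty μ Γ₂ :=
  biInf_mono fun _ hρ => ⟨hρ.1, fun γ hγ => hρ.2 γ (h hγ)⟩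

lemma exists_admissible_ae_le (μ : Measure X) {Γ : Set (Curve X)} {c : ℝ≥0∞}
    (h : ModInfty μ Γ < c) : ∃ ρ, Admissible Γ ρ ∧ ∀ᵐ x ∂μ, ρ x ≤ c := by
  simp only [ModInfty, iInf_lt_iff] at h
  obtain ⟨ρ, hρ, hlt⟩ := h
  exact ⟨ρ, hρ, (ENNReal.ae_le_essSup ρ).mono fun x hx => hx.trans hlt.le⟩

/-- The upper limit of a sequence of densities, made infinite on the set where one of the bounds
`ρ j ≤ c j` fails, is admissible for every curve for which almost all `ρ j` are. -/
lemma one_le_lineIntegral_limsup_add_indicator [BorelSpace X] {γ : Curve X} (hγ : γ.Rectifiable)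
    {ρ : ℕ → X → ℝ≥0∞} (hρ : ∀ j, Measurable (ρ j)) {c : ℕ → ℝ≥0∞} {C : ℝ≥0∞} (hC : C ≠ ∞)
    (hc : ∀ j, c j ≤ C) (h : ∀ᶠ j in atTop, 1 ≤ γ.lineIntegral (ρ j)) :
    1 ≤ γ.lineIntegral (fun x => limsup (fun j => ρ j x) atTop +
      (⋃ j, {x | c j < ρ j x}).indicator (fun _ => ∞) x) := by
  obtain ⟨ν, hν, hint⟩ := γ.exists_lineIntegral_eq_lintegral hγ
  have hE : MeasurableSet (⋃ j, {x | c j < ρ j x}) :=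
    .iUnion fun j => measurableSet_lt measurable_const (hρ j)
  have hlim : Measurable fun x => limsup (fun j => ρ j x) atTop := .limsup hρ
  rw [hint (fun x => limsup (fun j => ρ j x) atTop +
    (⋃ j, {x | c j < ρ j x}).indicator (fun _ => ∞) x)
    (hlim.add (measurable_const.indicator hE))]
  by_cases hν0 : ν (⋃ j, {x | c j < ρ j x}) = 0
  · have hbound : ∀ j, ρ j ≤ᵐ[ν] fun _ => C := fun j => by
      filter_upwards [measure_eq_zero_iff_ae_notMem.1 (measure_iUnion_null_iff.1 hν0 j)]
        with x hx using (not_lt.1 hx).trans (hc j)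
    calc (1 : ℝ≥0∞) ≤ limsup (fun j => ∫⁻ x, ρ j x ∂ν) atTop := by
          refine le_limsup_of_frequently_le (Eventually.frequently ?_)
          exact h.mono fun j hj => hint (ρ j) (hρ j) ▸ hj
      _ ≤ ∫⁻ x, limsup (fun j => ρ j x) atTop ∂ν :=
          limsup_lintegral_le _ hρ hbound (by
            simpa using ENNReal.mul_ne_top hC (measure_ne_top ν _))
      _ ≤ _ := lintegral_mono fun x => le_self_add
  · calc (1 : ℝ≥0∞) ≤ ∞ := le_top
      _ = ∫⁻ x, (⋃ j, {x | c j < ρ j x}).indicator (fun _ => ∞) x ∂ν := by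
          rw [lintegral_indicator_const hE, ENNReal.top_mul hν0]
      _ ≤ _ := lintegral_mono fun x => le_add_self

end Modulus

/-- `Mod_∞^*` is continuous from below: if `Γ₁ ⊆ Γ₂ ⊆ ⋯` then
`lim_j Mod_∞^*(Γ j) = Mod_∞^*(⋃ j, Γ j)`. -/
theorem modInfty_continuous_from_below {X : Type*} [MetricSpace X] [TopologicalSpace.SeparableSpace X]
    [MeasurableSpace X] [BorelSpace X] (μ : Measure X)
    (hμ : ∀ x : X, ∃ r > 0, 0 < μ (Metric.ball x r) ∧ μ (Metric.ball x r) < ∞)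
    (Γ : ℕ → Set (Curve X)) (hΓ : ∀ j, ∀ γ ∈ Γ j, γ.Rectifiable)
    (hmono : Monotone Γ) :
    Filter.Tendsto (fun j => ModInfty μ (Γ j)) Filter.atTop
      (nhds (ModInfty μ (⋃ j, Γ j))) := by
  have hmono' : Monotone fun j => ModInfty μ (Γ j) := fun i j hij => modInfty_mono μ (hmono hij)
  suffices hsup : ModInfty μ (⋃ j, Γ j) = ⨆ j, ModInfty μ (Γ j) from
    hsup ▸ tendsto_atTop_iSup hmono'
  refine le_antisymm ?_ (iSup_le fun j => modInfty_mono μ (Set.subset_iUnion Γ j))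
  set L := ⨆ j, ModInfty μ (Γ j)
  by_cases hL : L = ∞
  · exact hL ▸ le_top
  have hpos : ∀ j : ℕ, ((j : ℝ≥0∞) + 1)⁻¹ ≠ 0 := fun j => by simp
  choose ρ hadm hle using fun j : ℕ => exists_admissible_ae_le μ
    ((le_iSup (fun j => ModInfty μ (Γ j)) j).trans_lt (ENNReal.lt_add_right hL (hpos j)))
  have hlim : Filter.Tendsto (fun j : ℕ => L + ((j : ℝ≥0∞) + 1)⁻¹) Filter.atTop (nhds L) := by
    have h := (Filter.tendsto_add_atTop_iff_nat 1).2 ENNReal.tendsto_inv_nat_nhds_zero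
    simpa using tendsto_const_nhds.add h
  have hE : MeasurableSet (⋃ j : ℕ, {x | L + ((j : ℝ≥0∞) + 1)⁻¹ < ρ j x}) :=
    .iUnion fun j => measurableSet_lt measurable_const (hadm j).1
  refine (iInf₂_le (fun x => Filter.limsup (fun j => ρ j x) Filter.atTop +
    (⋃ j : ℕ, {x | L + ((j : ℝ≥0∞) + 1)⁻¹ < ρ j x}).indicator (fun _ => ∞) x)
    ⟨(Measurable.limsup fun j => (hadm j).1).add (measurable_const.indicator hE),
      fun γ hγ => ?_⟩).trans ?_
  · refine essSup_le_of_ae_le L ?_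
    filter_upwards [ae_all_iff.2 hle] with x hx
    rw [Set.indicator_of_notMem (by simpa using hx), add_zero, ← hlim.limsup_eq]
    exact Filter.limsup_le_limsup (Filter.Eventually.of_forall hx)
  · obtain ⟨i, hi⟩ := Set.mem_iUnion.1 hγ
    refine one_le_lineIntegral_limsup_add_indicator (hΓ i γ hi) (fun j => (hadm j).1)
      (C := L + 1) (by simp [hL]) (fun j => ?_) ?_
    · gcongr
      simp
    · filter_upwards [Filter.eventually_ge_atTop i] with j hj using (hadm j).2 γ (hmono hj hi)
end

section
/- For every family Γ of rectifiable curves in a metric measure space (X,d,μ), the two notions of ∞-modulus coincide: Mod_∞(Γ) = Mod_∞^*(Γ). -/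
open MeasureTheory
open scoped ENNReal

section Modulus

variable {X : Type*} [MetricSpace X] [MeasurableSpace X]

theorem modInfty_le {μ : Measure X} {Γ : Set (Curve X)} {ρ : X → ℝ≥0∞} (hρ : Admissible Γ ρ) :
    ModInfty μ Γ ≤ essSup ρ μ :=
  iInf₂_le ρ hρ

theorem exists_admissible_essSup_lt {μ : Measure X} {Γ : Set (Curve X)} {c : ℝ≥0∞}
    (h : ModInfty μ Γ < c) : ∃ ρ, Admissible Γ ρ ∧ essSup ρ μ < c := by
  simpa [ModInfty, iInf_lt_iff] using h

theorem exceptional_empty (μ : Measure X) : Exceptional μ (∅ : Set (Curve X)) := by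
  have h : Admissible (∅ : Set (Curve X)) (fun _ => 0) := ⟨measurable_const, by simp⟩
  exact le_antisymm ((modInfty_le h).trans
    (essSup_le_of_ae_le 0 (Filter.Eventually.of_forall fun _ => le_rfl))) bot_le

theorem Admissible.weaklyAdmissible {μ : Measure X} {Γ : Set (Curve X)} {ρ : X → ℝ≥0∞}
    (hρ : Admissible Γ ρ) : WeaklyAdmissible μ Γ ρ := by
  have h : {γ ∈ Γ | γ.lineIntegral ρ < 1} = ∅ :=
    Set.eq_empty_of_forall_notMem fun γ hγ => (hρ.2 γ hγ.1).not_gt hγ.2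
  exact ⟨hρ.1, h ▸ exceptional_empty μ⟩

theorem Curve.lineIntegral_mono {X : Type*} [MetricSpace X] (γ : Curve X) {ρ σ : X → ℝ≥0∞}
    (h : ρ ≤ σ) : γ.lineIntegral ρ ≤ γ.lineIntegral σ :=
  lintegral_mono fun _ => h _

/-- The maximum of a density `ρ` and a density admissible for the curves on which `ρ` fails
is admissible. -/
theorem Admissible.sup_of_measurable {Γ : Set (Curve X)} {ρ σ : X → ℝ≥0∞}
    (hσ : Admissible {γ ∈ Γ | γ.lineIntegral ρ < 1} σ) (hρ : Measurable ρ) :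
    Admissible Γ (ρ ⊔ σ) := by
  refine ⟨hρ.sup hσ.1, fun γ hγ => ?_⟩
  rcases lt_or_ge (γ.lineIntegral ρ) 1 with h | h
  · exact (hσ.2 γ ⟨hγ, h⟩).trans (γ.lineIntegral_mono le_sup_right)
  · exact h.trans (γ.lineIntegral_mono le_sup_left)

theorem WeaklyAdmissible.modInfty_le {μ : Measure X} {Γ : Set (Curve X)} {ρ : X → ℝ≥0∞}
    (hρ : WeaklyAdmissible μ Γ ρ) : ModInfty μ Γ ≤ essSup ρ μ := by
  refine le_of_forall_gt_imp_ge_of_dense fun c hc => ?_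
  obtain ⟨σ, hσ, hσc⟩ := exists_admissible_essSup_lt (hρ.2.trans_lt (bot_le.trans_lt hc))
  refine (_root_.modInfty_le (hσ.sup_of_measurable hρ.1)).trans (essSup_le_of_ae_le c ?_)
  filter_upwards [ae_le_essSup (f := ρ) (μ := μ), ae_le_essSup (f := σ) (μ := μ)] with x h₁ h₂
  exact sup_le (h₁.trans hc.le) (h₂.trans hσc.le)

end Modulus

/-- The two notions of `∞`-modulus coincide: `Mod_∞(Γ) = Mod_∞^*(Γ)` for every family of
rectifiable curves. -/
theorem modInftyW_eq_modInfty {X : Type*} [MetricSpace X] [TopologicalSpace.SeparableSpace X]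
    [MeasurableSpace X] [BorelSpace X] (μ : Measure X)
    (hμ : ∀ x : X, ∃ r > 0, 0 < μ (Metric.ball x r) ∧ μ (Metric.ball x r) < ∞)
    (Γ : Set (Curve X)) (hΓ : ∀ γ ∈ Γ, γ.Rectifiable) :
    ModInftyW μ Γ = ModInfty μ Γ :=
  le_antisymm (le_iInf₂ fun ρ hρ => iInf₂_le ρ (Admissible.weaklyAdmissible hρ))
    (le_iInf₂ fun ρ hρ => WeaklyAdmissible.modInfty_le hρ)
end

section
/- Let (X,d,μ) be a metric measure space with μ Borel, and let Γ be a family of rectifiable curves in X with essℓ(Γ) = 0. Then Mod_∞(Γ) = ∞; more precisely, no density ρ with ‖ρ‖_∞ < ∞ is weakly admissible for Γ. -/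
open MeasureTheory
open scoped ENNReal

theorem Curve.volume_paramDomain_le {X : Type*} [MetricSpace X] (γ : Curve X) :
    volume γ.paramDomain ≤ γ.length := by
  rcases eq_or_ne γ.length ∞ with h | h
  · simp [h]
  · calc volume γ.paramDomain ≤ volume (Set.Icc 0 γ.length.toReal) :=
          measure_mono fun t ht => ⟨ht.1, (ENNReal.ofReal_le_iff_le_toReal h).1 ht.2⟩
      _ = γ.length := by simp [Real.volume_Icc, ENNReal.ofReal_toReal h]

/-- If `f ≤ K` outside `N`, `∫_γ f ds ≥ 1` and `K * length γ < 1`, then the line integral of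
`∞ · 1_N` along `γ` is infinite. No measurability is required. -/
theorem Curve.lineIntegral_indicator_top_eq_top {X : Type*} [MetricSpace X] (γ : Curve X)
    {f : X → ℝ≥0∞} {N : Set X} {K : ℝ≥0∞} (hf : ∀ x ∉ N, f x ≤ K)
    (h1 : 1 ≤ γ.lineIntegral f) (hK : K * γ.length < 1) :
    γ.lineIntegral (N.indicator fun _ => ∞) = ∞ := by
  have hle : γ.lineIntegral f ≤
      K * γ.length + γ.lineIntegral (N.indicator fun _ => ∞) := by
    calc γ.lineIntegral f
        ≤ ∫⁻ t in γ.paramDomain, (K + N.indicator (fun _ => ∞) (γ.param t)) := by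
          refine lintegral_mono fun t => ?_
          by_cases ht : γ.param t ∈ N
          · simp [ht]
          · simpa [ht] using hf _ ht
      _ = K * volume γ.paramDomain + γ.lineIntegral (N.indicator fun _ => ∞) := by
          rw [lintegral_add_left measurable_const, setLIntegral_const]
          rfl
      _ ≤ _ := by
          gcongr
          exact γ.volume_paramDomain_le
  have hne : γ.lineIntegral (N.indicator fun _ => ∞) ≠ 0 := by
    intro h0
    rw [h0, add_zero] at hle
    exact absurd (h1.trans hle) hK.not_ge
  have hscale : ∞ * γ.lineIntegral (N.indicator fun _ => ∞) ≤
      γ.lineIntegral (N.indicator fun _ => ∞) := by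
    refine (lintegral_const_mul_le _ _).trans (lintegral_mono fun t => ?_)
    by_cases ht : γ.param t ∈ N <;> simp [ht]
  rw [ENNReal.top_mul hne] at hscale
  exact top_le_iff.1 hscale

theorem exceptional_of_null {X : Type*} [MetricSpace X] [MeasurableSpace X] [BorelSpace X]
    {μ : Measure X} {Γ : Set (Curve X)} {N : Set X} (hN : MeasurableSet N) (hμN : μ N = 0)
    (hΓ : ∀ γ ∈ Γ, γ.lineIntegral (N.indicator fun _ => ∞) = ∞) : Exceptional μ Γ := by
  have hadm : Admissible Γ (N.indicator fun _ => ∞) :=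
    ⟨measurable_const.indicator hN, fun γ hγ => by simp [hΓ γ hγ]⟩
  have hess : essSup (N.indicator fun _ => ∞) μ = (0 : ℝ≥0∞) :=
    ENNReal.essSup_eq_zero_iff.2 (indicator_meas_zero hμN)
  exact le_antisymm ((iInf₂_le _ hadm).trans hess.le) zero_le

/-- The short curves of `Γ` are exceptional as soon as `Γ` has a weakly admissible density with
finite essential supremum. -/
theorem WeaklyAdmissible.exceptional_length_lt {X : Type*} [MetricSpace X] [MeasurableSpace X]
    [BorelSpace X] {μ : Measure X} {Γ : Set (Curve X)} {ρ : X → ℝ≥0∞}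
    (hρ : WeaklyAdmissible μ Γ ρ) (hfin : essSup ρ μ ≠ ∞) :
    Exceptional μ {γ ∈ Γ | γ.length < (essSup ρ μ + 1)⁻¹} := by
  obtain ⟨hρm, hexc⟩ := hρ
  obtain ⟨h, ⟨hhm, hadm⟩, hh1⟩ :
      ∃ h, Admissible {γ ∈ Γ | γ.lineIntegral ρ < 1} h ∧ essSup h μ < 1 := by
    have hlt : ModInfty μ {γ ∈ Γ | γ.lineIntegral ρ < 1} < 1 :=
      lt_of_eq_of_lt hexc one_pos
    simpa [ModInfty, iInf_lt_iff] using hlt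
  set K := essSup ρ μ + 1
  have hK0 : K ≠ 0 := by simp [K]
  have hKtop : K ≠ ∞ := by simp [K, hfin]
  have hnull : μ ({x | K < ρ x} ∪ {x | K < h x}) = 0 := by
    refine measure_union_null ?_ ?_
    · refine measure_mono_null (fun x (hx : K < ρ x) => ?_) (meas_essSup_lt (f := ρ) (μ := μ))
      exact lt_of_le_of_lt le_self_add hx
    · refine measure_mono_null (fun x (hx : K < h x) => ?_) (meas_essSup_lt (f := h) (μ := μ))
      exact hh1.trans_le (le_add_self.trans hx.le)
  refine exceptional_of_null ((measurableSet_lt measurable_const hρm).union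
    (measurableSet_lt measurable_const hhm)) hnull fun γ hγ => ?_
  have hKγ : K * γ.length < 1 := by
    have := ENNReal.mul_lt_mul_right hK0 hKtop hγ.2
    rwa [ENNReal.mul_inv_cancel hK0 hKtop] at this
  rcases le_or_gt 1 (γ.lineIntegral ρ) with h1 | h1
  · exact γ.lineIntegral_indicator_top_eq_top
      (fun x hx => not_lt.1 fun hlt => hx (Or.inl hlt)) h1 hKγ
  · exact γ.lineIntegral_indicator_top_eq_top
      (fun x hx => not_lt.1 fun hlt => hx (Or.inr hlt)) (hadm γ ⟨hγ.1, h1⟩) hKγ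

/-- If `essℓ(Γ) = 0`, then `Mod_∞(Γ) = ∞`; more precisely, no density with finite
essential supremum is weakly admissible for `Γ`. -/
theorem modInftyW_eq_top_of_essLen_zero {X : Type*} [MetricSpace X] [TopologicalSpace.SeparableSpace X]
    [MeasurableSpace X] [BorelSpace X] (μ : Measure X)
    (hμ : ∀ x : X, ∃ r > 0, 0 < μ (Metric.ball x r) ∧ μ (Metric.ball x r) < ∞)
    (Γ : Set (Curve X)) (hΓ : ∀ γ ∈ Γ, γ.Rectifiable)
    (hz : essLen μ Γ = 0) :
    ModInftyW μ Γ = ∞ ∧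
    ∀ ρ : X → ℝ≥0∞, essSup ρ μ ≠ ∞ → ¬ WeaklyAdmissible μ Γ ρ := by
  have main : ∀ ρ : X → ℝ≥0∞, essSup ρ μ ≠ ∞ → ¬ WeaklyAdmissible μ Γ ρ := by
    intro ρ hfin hρ
    have hle : (essSup ρ μ + 1)⁻¹ ≤ essLen μ Γ := le_sSup (hρ.exceptional_length_lt hfin)
    rw [hz, nonpos_iff_eq_zero, ENNReal.inv_eq_zero] at hle
    simp [hfin] at hle
  refine ⟨?_, main⟩
  refine iInf₂_eq_top.2 fun ρ hρ => ?_
  by_contra hne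
  exact main ρ hne hρ
end
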